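/- arXiv:1503.03147 — 3 statements merged into one kernel-verified Lean document; each statement's English description precedes it below -/
import Mathlib

section
/- Let (x_λ) be a d-reflexive net in X and x ∈ X. Then x is an X°°-limit of (x_λ), i.e. liminf_λ d(x_λ,c) ≥ d(x,c) and liminf_λ d(c,x_λ) ≥ d(c,x) for all c ∈ X, if and only if lim_λ d(x_λ,c) = d(x,c) for all c ∈ X and d(x,x) = 0. -/
open scoped ENNReal

universe u v

/-- liminf of a `[0,∞]`-valued net indexed by a set with relation `r`. -/
noncomputable def netLiminf {ι : Type v} (r : ι → ι → Prop) (f : ι → ℝ≥0∞) : ℝ≥0∞ :=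
  ⨆ γ : ι, ⨅ l : ι, ⨅ _ : r γ l, f l

/-- limsup of a `[0,∞]`-valued net indexed by a set with relation `r`. -/
noncomputable def netLimsup {ι : Type v} (r : ι → ι → Prop) (f : ι → ℝ≥0∞) : ℝ≥0∞ :=
  ⨅ γ : ι, ⨆ l : ι, ⨆ _ : r γ l, f l

/-- `lim f = L` : both liminf and limsup equal `L`. -/
def NetLimEq {ι : Type v} (r : ι → ι → Prop) (f : ι → ℝ≥0∞) (L : ℝ≥0∞) : Prop :=
  netLiminf r f = L ∧ netLimsup r f = L

/-- `d` satisfies the triangle inequality. -/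
def IsDistance {X : Type u} (d : X → X → ℝ≥0∞) : Prop :=
  ∀ x y z, d x z ≤ d x y + d y z

/-- the index relation is transitive and directed. -/
def DirectedIndex {ι : Type v} (r : ι → ι → Prop) : Prop :=
  (∀ a b c : ι, r a b → r b c → r a c) ∧ (∀ a b : ι, ∃ c, r a c ∧ r b c)

/-- `d`-Cauchy net. -/
def IsCauchyNet {X : Type u} {ι : Type v} (d : X → X → ℝ≥0∞) (r : ι → ι → Prop)
    (x : ι → X) : Prop :=
  ∀ ε : ℝ≥0∞, 0 < ε → ∃ α, ∀ γ δ, r α γ → r γ δ → d (x γ) (x δ) < ε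

/-- `d`-pre-Cauchy net. -/
def IsPreCauchyNet {X : Type u} {ι : Type v} (d : X → X → ℝ≥0∞) (r : ι → ι → Prop)
    (x : ι → X) : Prop :=
  ∀ ε : ℝ≥0∞, 0 < ε → ∃ α, ∀ γ, r α γ → ∃ β, ∀ δ, r β δ → d (x γ) (x δ) < ε

/-- `d`-reflexive net. -/
def IsReflexiveNet {X : Type u} {ι : Type v} (d : X → X → ℝ≥0∞) (r : ι → ι → Prop)
    (x : ι → X) : Prop :=
  ∀ ε : ℝ≥0∞, 0 < ε → ∃ α, ∀ γ, r α γ → ∀ β, ∃ δ, r β δ ∧ d (x γ) (x δ) < ε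

/-- `x` is a `d`-supremum of `Y`. -/
def IsDSup {X : Type u} (d : X → X → ℝ≥0∞) (Y : Set X) (x : X) : Prop :=
  (∀ y ∈ Y, d y x = 0) ∧ ∀ z, d x z = ⨆ y ∈ Y, d y z

/-- `x` is a `≤ᵈ`-supremum of `Y`. -/
def IsLeDSup {X : Type u} (d : X → X → ℝ≥0∞) (Y : Set X) (x : X) : Prop :=
  (∀ y ∈ Y, d y x = 0) ∧ ∀ z, (∀ y ∈ Y, d y z = 0) → d x z = 0

/-- `Y` is `d`-directed. -/
def DDirected {X : Type u} (d : X → X → ℝ≥0∞) (Y : Set X) : Prop :=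
  ∀ F : Finset X, ↑F ⊆ Y → ∀ ε : ℝ≥0∞, 0 < ε → ∃ y ∈ Y, ∀ z ∈ F, d z y < ε

/-- `Y` is `≤ᵈ`-directed (directed sets are nonempty). -/
def LeDDirected {X : Type u} (d : X → X → ℝ≥0∞) (Y : Set X) : Prop :=
  Y.Nonempty ∧ ∀ y₁ ∈ Y, ∀ y₂ ∈ Y, ∃ y ∈ Y, d y₁ y = 0 ∧ d y₂ y = 0

/-- `X` is `f`-complete: every `f`-Cauchy net has an `X°°`-limit w.r.t. `f`. -/
def IsYonedaComplete {X : Type u} (f : X → X → ℝ≥0∞) : Prop :=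
  ∀ (ι : Type u) (r : ι → ι → Prop) (x : ι → X), Nonempty ι → DirectedIndex r →
    IsCauchyNet f r x →
    ∃ z : X, (∀ c, f z c ≤ netLiminf r fun l => f (x l) c) ∧
             (∀ c, f c z ≤ netLiminf r fun l => f c (x l))

/-- `d^•(s) = sup_x inf { d(x,y) : y ≤ᵈ x^•_s }`. -/
noncomputable def dBulletUpper {X : Type u} (d : X → X → ℝ≥0∞) (s : ℝ≥0∞) : ℝ≥0∞ :=
  ⨆ x : X, ⨅ y : X, ⨅ _ : ∀ z, d x z < s → d y z = 0, d x y

/-- `d_•(s) = sup_x inf { d(y,x) : x^s_• ≤ᵈ y }`. -/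
noncomputable def dBulletLower {X : Type u} (d : X → X → ℝ≥0∞) (s : ℝ≥0∞) : ℝ≥0∞ :=
  ⨆ x : X, ⨅ y : X, ⨅ _ : ∀ z, d z x < s → d z y = 0, d y x

/-- `d_F(s)`. -/
noncomputable def dFin {X : Type u} (d : X → X → ℝ≥0∞) (s : ℝ≥0∞) : ℝ≥0∞ :=
  ⨆ x : X, ⨆ F : Finset X, ⨆ _ : ∀ z ∈ F, d z x < s,
    ⨅ y : X, ⨅ _ : ∀ z ∈ F, d z y = 0, d y x

/-- `d_Φ(s)`. -/
noncomputable def dPhi {X : Type u} (d : X → X → ℝ≥0∞) (s : ℝ≥0∞) : ℝ≥0∞ :=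
  ⨆ x : X, ⨆ F : Finset X, ⨆ _ : ∀ z ∈ F, d z x < s, ⨆ ε : ℝ≥0∞, ⨆ _ : 0 < ε,
    ⨅ y : X, ⨅ _ : ∀ z ∈ F, d z y < ε, d y x

/-- `e∘Φᵈ(x,y) = sup_{ε>0} inf { e(x,z) : d(z,y) < ε }`. -/
noncomputable def ePhiD {X : Type u} (e d : X → X → ℝ≥0∞) (x y : X) : ℝ≥0∞ :=
  ⨆ ε : ℝ≥0∞, ⨆ _ : 0 < ε, ⨅ z : X, ⨅ _ : d z y < ε, e x z

/-- `f ⪅ g` : uniform subequivalence. -/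
def SubEquiv {X : Type u} (f g : X → X → ℝ≥0∞) : Prop :=
  ∀ ε : ℝ≥0∞, 0 < ε → ∃ δ : ℝ≥0∞, 0 < δ ∧ ∀ x y, g x y ≤ δ → f x y ≤ ε

theorem le_netLiminf {ι : Type v} {r : ι → ι → Prop} {f : ι → ℝ≥0∞} {a : ℝ≥0∞} (γ : ι)
    (h : ∀ l, r γ l → a ≤ f l) : a ≤ netLiminf r f :=
  le_iSup_of_le γ (le_iInf₂ h)

theorem netLimsup_le {ι : Type v} {r : ι → ι → Prop} {f : ι → ℝ≥0∞} {a : ℝ≥0∞} (γ : ι)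
    (h : ∀ l, r γ l → f l ≤ a) : netLimsup r f ≤ a :=
  iInf_le_of_le γ (iSup₂_le h)

theorem netLiminf_le_of_frequently {ι : Type v} {r : ι → ι → Prop} {f : ι → ℝ≥0∞} {a : ℝ≥0∞}
    (h : ∀ β, ∃ δ, r β δ ∧ f δ ≤ a) : netLiminf r f ≤ a := by
  refine iSup_le fun β => ?_
  obtain ⟨δ, hδ, hle⟩ := h β
  exact (iInf₂_le δ hδ).trans hle

theorem netLiminf_le_netLimsup {ι : Type v} {r : ι → ι → Prop} (hr : DirectedIndex r)
    (f : ι → ℝ≥0∞) : netLiminf r f ≤ netLimsup r f := by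
  refine le_iInf fun β => netLiminf_le_of_frequently fun γ => ?_
  obtain ⟨l, hγ, hβ⟩ := hr.2 γ β
  exact ⟨l, hγ, le_iSup₂ (f := fun l (_ : r β l) => f l) l hβ⟩

theorem eventually_le_of_netLimsup_lt {ι : Type v} {r : ι → ι → Prop} {f : ι → ℝ≥0∞} {a : ℝ≥0∞}
    (h : netLimsup r f < a) : ∃ γ, ∀ l, r γ l → f l ≤ a := by
  obtain ⟨γ, hγ⟩ := iInf_lt_iff.1 h
  exact ⟨γ, fun l hl => (le_iSup₂ (f := fun l (_ : r γ l) => f l) l hl).trans hγ.le⟩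

/-- A reflexive net tends to any point `x₀` with `d(c,x₀) ≤ liminf d(c,x_λ)` for all `c`. -/
theorem IsReflexiveNet.eventually_le {X : Type u} {ι : Type v} {d : X → X → ℝ≥0∞}
    {r : ι → ι → Prop} {x : ι → X} (hx : IsReflexiveNet d r x) {x₀ : X}
    (h : ∀ c : X, d c x₀ ≤ netLiminf r fun l => d c (x l)) {ε : ℝ≥0∞} (hε : 0 < ε) :
    ∃ α, ∀ γ, r α γ → d (x γ) x₀ ≤ ε := by
  obtain ⟨α, hα⟩ := hx ε hε
  refine ⟨α, fun γ hγ => (h (x γ)).trans (netLiminf_le_of_frequently fun β => ?_)⟩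
  obtain ⟨δ, hδ, hlt⟩ := hα γ hγ β
  exact ⟨δ, hδ, hlt.le⟩

/-- For a d-reflexive net, `x` is an `X°°`-limit iff `d(x_λ,c) → d(x,c)` for all `c`
and `d(x,x) = 0`. -/
theorem doubleHole_limit_iff {X : Type u} {ι : Type v}
    (d : X → X → ℝ≥0∞) (hd : IsDistance d)
    (r : ι → ι → Prop) (hne : Nonempty ι) (hr : DirectedIndex r)
    (x : ι → X) (hx : IsReflexiveNet d r x) (x₀ : X) :
    ((∀ c : X, d x₀ c ≤ netLiminf r fun l => d (x l) c) ∧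
     (∀ c : X, d c x₀ ≤ netLiminf r fun l => d c (x l))) ↔
    ((∀ c : X, NetLimEq r (fun l => d (x l) c) (d x₀ c)) ∧ d x₀ x₀ = 0) := by
  constructor
  · rintro ⟨hl, hu⟩
    have hlim : ∀ c, netLimsup r (fun l => d (x l) c) ≤ d x₀ c := by
      refine fun c => ENNReal.le_of_forall_pos_le_add fun ε hε _ => ?_
      obtain ⟨α, hα⟩ := hx.eventually_le hu (ENNReal.coe_pos.2 hε)
      refine netLimsup_le α fun l hrl => (hd _ x₀ _).trans ?_
      rw [add_comm]
      gcongr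
      exact hα l hrl
    refine ⟨fun c => ⟨le_antisymm ((netLiminf_le_netLimsup hr _).trans (hlim c)) (hl c),
      le_antisymm (hlim c) ((hl c).trans (netLiminf_le_netLimsup hr _))⟩, ?_⟩
    refine le_antisymm (le_of_forall_gt_imp_ge_of_dense fun ε hε => ?_) zero_le
    obtain ⟨α, hα⟩ := hx.eventually_le hu hε
    exact (hl x₀).trans ((netLiminf_le_netLimsup hr _).trans (netLimsup_le α hα))
  · rintro ⟨hlim, h0⟩
    refine ⟨fun c => (hlim c).1.ge, fun c => ?_⟩
    refine ENNReal.le_of_forall_pos_le_add fun ε hε _ => ?_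
    have hlt : netLimsup r (fun l => d (x l) x₀) < ε := by
      rw [(hlim x₀).2, h0]
      exact ENNReal.coe_pos.2 hε
    obtain ⟨α, hα⟩ := eventually_le_of_netLimsup_lt hlt
    refine tsub_le_iff_right.1 (le_netLiminf α fun l hrl => tsub_le_iff_right.2 ?_)
    refine (hd c (x l) x₀).trans ?_
    gcongr
    exact hα l hrl
end

section
/- Let Y ⊆ X be d-directed and let (x_λ) be a d-pre-Cauchy net in X. Then lim_λ d(y,x_λ) = 0 for all y ∈ Y if and only if lim_λ d(x,x_λ) ≤ inf_{y∈Y} d(x,y) for all x ∈ X (these limits exist since (x_λ) is d-pre-Cauchy). -/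
open scoped ENNReal

universe u v

theorem netLimEq_zero_iff {ι : Type v} {r : ι → ι → Prop} (hr : DirectedIndex r)
    (f : ι → ℝ≥0∞) : NetLimEq r f 0 ↔ netLimsup r f = 0 :=
  ⟨fun h => h.2, fun h => ⟨le_bot_iff.1 ((netLiminf_le_netLimsup hr f).trans_eq h), h⟩⟩

theorem netLimsup_dist_le_add {X : Type u} {ι : Type v} {d : X → X → ℝ≥0∞} (hd : IsDistance d)
    (r : ι → ι → Prop) (x : ι → X) (c y : X) :
    netLimsup r (fun l => d c (x l)) ≤ d c y + netLimsup r (fun l => d y (x l)) := by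
  unfold netLimsup
  rw [ENNReal.add_iInf]
  refine iInf_mono fun γ => iSup₂_le fun l hl => (hd c y (x l)).trans ?_
  gcongr
  exact le_iSup₂ (f := fun l (_ : r γ l) => d y (x l)) l hl

theorem DDirected.iInf_dist_eq_zero {X : Type u} {d : X → X → ℝ≥0∞} {Y : Set X}
    (hY : DDirected d Y) {y : X} (hy : y ∈ Y) : ⨅ z ∈ Y, d y z = 0 := by
  refine le_bot_iff.1 (le_of_forall_gt fun ε hε => ?_)
  obtain ⟨z, hz, hyz⟩ := hY {y} (by simpa using hy) ε hε
  exact (iInf₂_le z hz).trans_lt (hyz y (Finset.mem_singleton_self y))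

/-- For d-directed `Y` and d-pre-Cauchy `(x_λ)`:
`Y ≤ᵈ (x_λ)` iff `lim_λ d(c,x_λ) ≤ inf_{y ∈ Y} d(c,y)` for all `c`. -/
theorem cofinal_iff_dist_le {X : Type u} {ι : Type v}
    (d : X → X → ℝ≥0∞) (hd : IsDistance d)
    (r : ι → ι → Prop) (hne : Nonempty ι) (hr : DirectedIndex r)
    (x : ι → X) (hx : IsPreCauchyNet d r x)
    (Y : Set X) (hY : DDirected d Y) :
    (∀ y ∈ Y, NetLimEq r (fun l => d y (x l)) 0) ↔
      (∀ c : X, netLimsup r (fun l => d c (x l)) ≤ ⨅ y ∈ Y, d c y) := by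
  simp only [netLimEq_zero_iff hr]
  constructor
  · intro h c
    refine le_iInf₂ fun y hy => (netLimsup_dist_le_add hd r x c y).trans ?_
    rw [h y hy, add_zero]
  · intro h y hy
    exact le_bot_iff.1 ((h y).trans_eq (hY.iInf_dist_eq_zero hy))
end

section
/- Suppose X is ≤^d-d-complete and sup_{s∈[0,r]} d^•(s) → 0 as r → 0⁺ (i.e. for every ε > 0 there is r > 0 with d^•(s) ≤ ε for all s ≤ r), where d^•(r) = sup_{x∈X} inf { d(x,y) : y ∈ X such that d(y,z) = 0 for every z with d(x,z) < r }. Then X is d-complete. -/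
open scoped ENNReal

universe u v

/-- If `d^•(s) < ε`, every point `x` is within `ε` of a `≤ᵈ`-lower bound of its `s`-ball. -/
theorem exists_lt_of_dBulletUpper_lt {X : Type u} {d : X → X → ℝ≥0∞} {s ε : ℝ≥0∞}
    (h : dBulletUpper d s < ε) (x : X) :
    ∃ y, (∀ z, d x z < s → d y z = 0) ∧ d x y < ε := by
  have hx := (le_iSup (fun x : X => ⨅ y : X, ⨅ _ : ∀ z, d x z < s → d y z = 0, d x y) x).trans_lt h
  simpa [iInf_lt_iff] using hx

/-- The points lying `≤ᵈ`-below some uniform neighbourhood of a tail of the net `x`. -/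
def wayBelowTail {X : Type u} {ι : Type v} (d : X → X → ℝ≥0∞) (r : ι → ι → Prop)
    (x : ι → X) : Set X :=
  {y | ∃ s : ℝ≥0∞, 0 < s ∧ ∃ α, ∀ δ, r α δ → ∀ z, d (x δ) z < s → d y z = 0}

section CauchyNet

variable {X : Type u} {ι : Type v} {d : X → X → ℝ≥0∞} {r : ι → ι → Prop} {x : ι → X}

theorem exists_mem_wayBelowTail_lt (hd : IsDistance d)
    (hb : ∀ ε : ℝ≥0∞, 0 < ε → ∃ t : ℝ≥0∞, 0 < t ∧ ∀ s ≤ t, dBulletUpper d s ≤ ε)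
    (hx : IsCauchyNet d r x) {ε : ℝ≥0∞} (hε : 0 < ε) :
    ∃ α, ∀ γ, r α γ → ∃ y ∈ wayBelowTail d r x, d (x γ) y < ε := by
  obtain ⟨ε', hε', hlt⟩ := exists_between hε
  obtain ⟨t, ht, hbt⟩ := hb ε' hε'
  have ht2 : 0 < t / 2 := ENNReal.half_pos ht.ne'
  obtain ⟨α, hα⟩ := hx (t / 2) ht2
  refine ⟨α, fun γ hγ => ?_⟩
  obtain ⟨y, hy, hyε⟩ := exists_lt_of_dBulletUpper_lt ((hbt t le_rfl).trans_lt hlt) (x γ)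
  refine ⟨y, ⟨t / 2, ht2, γ, fun δ hδ z hz => hy z ?_⟩, hyε⟩
  calc d (x γ) z ≤ d (x γ) (x δ) + d (x δ) z := hd _ _ _
    _ < t / 2 + t / 2 := ENNReal.add_lt_add (hα γ δ hγ hδ) hz
    _ = t := ENNReal.add_halves t

theorem leDDirected_wayBelowTail [Nonempty ι] (hd : IsDistance d)
    (hb : ∀ ε : ℝ≥0∞, 0 < ε → ∃ t : ℝ≥0∞, 0 < t ∧ ∀ s ≤ t, dBulletUpper d s ≤ ε)
    (hr : DirectedIndex r) (hx : IsCauchyNet d r x) :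
    LeDDirected d (wayBelowTail d r x) := by
  obtain ⟨htrans, hdir⟩ := hr
  constructor
  · obtain ⟨α, hα⟩ := exists_mem_wayBelowTail_lt hd hb hx one_pos
    obtain ⟨γ, hγ, -⟩ := hdir α α
    obtain ⟨y, hy, -⟩ := hα γ hγ
    exact ⟨y, hy⟩
  · rintro y₁ ⟨s₁, hs₁, α₁, h₁⟩ y₂ ⟨s₂, hs₂, α₂, h₂⟩
    obtain ⟨α, hα⟩ := exists_mem_wayBelowTail_lt hd hb hx (lt_min hs₁ hs₂)
    obtain ⟨β, hβ₁, hβ₂⟩ := hdir α₁ α₂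
    obtain ⟨γ, hγα, hγβ⟩ := hdir α β
    obtain ⟨y, hy, hlt⟩ := hα γ hγα
    exact ⟨y, hy, h₁ γ (htrans _ _ _ hβ₁ hγβ) y (hlt.trans_le (min_le_left _ _)),
      h₂ γ (htrans _ _ _ hβ₂ hγβ) y (hlt.trans_le (min_le_right _ _))⟩

/-- A member of `wayBelowTail d r x` is eventually `≤ᵈ`-below the Cauchy net `x`. -/
theorem exists_forall_eq_zero_of_mem_wayBelowTail (hr : DirectedIndex r)
    (hx : IsCauchyNet d r x) {y : X} (hy : y ∈ wayBelowTail d r x) :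
    ∃ γ, ∀ l, r γ l → d y (x l) = 0 := by
  obtain ⟨s, hs, α, h⟩ := hy
  obtain ⟨β, hβ⟩ := hx s hs
  obtain ⟨γ, hγα, hγβ⟩ := hr.2 α β
  exact ⟨γ, fun l hl => h γ hγα _ (hβ γ l hγβ hl)⟩

end CauchyNet

/-- If `X` is `≤ᵈ`-d-complete and `d^• ⪅ I` then `X` is d-complete. -/
theorem yoneda_complete_of_leDD_complete {X : Type u}
    (d : X → X → ℝ≥0∞) (hd : IsDistance d)
    (hcomp : ∀ Y : Set X, LeDDirected d Y → ∃ x : X, IsDSup d Y x)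
    (hb : ∀ ε : ℝ≥0∞, 0 < ε → ∃ t : ℝ≥0∞, 0 < t ∧ ∀ s ≤ t, dBulletUpper d s ≤ ε) :
    IsYonedaComplete d := by
  intro ι r x _ hr hx
  obtain ⟨z, hzub, hz⟩ := hcomp _ (leDDirected_wayBelowTail hd hb hr hx)
  refine ⟨z, fun c => ?_, fun c => ?_⟩
  · rw [hz c]
    refine iSup₂_le fun y hy => ?_
    obtain ⟨γ, hγ⟩ := exists_forall_eq_zero_of_mem_wayBelowTail hr hx hy
    refine le_netLiminf γ fun l hl => ?_
    simpa [hγ l hl] using hd y (x l) c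
  · refine ENNReal.le_of_forall_pos_le_add fun ε hε _ => ?_
    obtain ⟨α, hα⟩ := exists_mem_wayBelowTail_lt hd hb hx (ENNReal.coe_pos.2 hε)
    refine tsub_le_iff_right.1 (le_netLiminf α fun l hl => tsub_le_iff_right.2 ?_)
    obtain ⟨y, hy, hlt⟩ := hα l hl
    calc d c z ≤ d c (x l) + d (x l) z := hd _ _ _
      _ ≤ d c (x l) + (d (x l) y + d y z) := by gcongr; exact hd _ _ _
      _ ≤ d c (x l) + ε := by rw [hzub y hy, add_zero]; gcongr
end
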